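/- arXiv:1912.09512 — 2 statements merged into one kernel-verified Lean document; each statement's English description precedes it below -/
import Mathlib

section
/- (Lemma 1.) Let V = {1, 2, …, n} ⊆ ℕ and let μ : ℕ → ℝ satisfy 1 ≥ μ(1) ≥ μ(2) ≥ ⋯ ≥ μ(n) ≥ 0. Fix a threshold Y ∈ ℕ, a unit cost η ≥ 0, and a cardinality n_g with 1 ≤ n_g ≤ n. Then among all subsets A ⊆ V with |A| = n_g, the set A* = {1, 2, …, n_g} of the n_g devices with the largest success probabilities achieves the largest expected reward: u(μ, A) ≤ u(μ, A*) for every A ⊆ V with |A| = n_g. -/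
/-- Success probability: probability that at least `Y` devices in `A` succeed. -/
noncomputable def S (μ : ℕ → ℝ) (A : Finset ℕ) (Y : ℕ) : ℝ :=
  ∑ A' ∈ A.powerset.filter (fun A' => Y ≤ A'.card),
    (∏ ν ∈ A', μ ν) * (∏ ν ∈ A \ A', (1 - μ ν))

/-- Expected reward of an offloading decision `A`. -/
noncomputable def u (μ : ℕ → ℝ) (Y : ℕ) (η : ℝ) (A : Finset ℕ) : ℝ :=
  S μ A Y - η * A.card

/-- Conditioning the success probability on the outcome of one device. -/
theorem S_insert (μ : ℕ → ℝ) {a : ℕ} {A : Finset ℕ} (ha : a ∉ A) (Y : ℕ) :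
    S μ (insert a A) Y = S μ A Y + μ a * (S μ A (Y - 1) - S μ A Y) := by
  simp only [S, Finset.sum_filter, Finset.sum_powerset_insert ha]
  have h₁ : ∀ t ∈ A.powerset,
      (if Y ≤ t.card then (∏ ν ∈ t, μ ν) * ∏ ν ∈ insert a A \ t, (1 - μ ν) else 0) =
      (1 - μ a) *
        (if Y ≤ t.card then (∏ ν ∈ t, μ ν) * ∏ ν ∈ A \ t, (1 - μ ν) else 0) := by
    intro t ht
    have hat : a ∉ t := fun h => ha (Finset.mem_powerset.1 ht h)
    rw [Finset.insert_sdiff_of_notMem _ hat, Finset.prod_insert (by simp [ha])]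
    split_ifs <;> ring
  have h₂ : ∀ t ∈ A.powerset,
      (if Y ≤ (insert a t).card then
        (∏ ν ∈ insert a t, μ ν) * ∏ ν ∈ insert a A \ insert a t, (1 - μ ν) else 0) =
      μ a *
        (if Y - 1 ≤ t.card then (∏ ν ∈ t, μ ν) * ∏ ν ∈ A \ t, (1 - μ ν) else 0) := by
    intro t ht
    have hat : a ∉ t := fun h => ha (Finset.mem_powerset.1 ht h)
    have hs : insert a A \ insert a t = A \ t := by
      ext x
      simp only [Finset.mem_sdiff, Finset.mem_insert]
      grind
    rw [hs, Finset.prod_insert hat, Finset.card_insert_of_notMem hat]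
    simp only [← Nat.sub_le_iff_le_add]
    split_ifs <;> ring
  rw [Finset.sum_congr rfl h₁, Finset.sum_congr rfl h₂, ← Finset.mul_sum, ← Finset.mul_sum]
  ring

theorem S_antitone (μ : ℕ → ℝ) {A : Finset ℕ} (h : ∀ i ∈ A, 0 ≤ μ i ∧ μ i ≤ 1) :
    Antitone (S μ A) := by
  intro Y Z hYZ
  refine Finset.sum_le_sum_of_subset_of_nonneg
    (Finset.monotone_filter_right _ fun _ _ hZ => hYZ.trans hZ) fun t ht _ => ?_
  have ht : t ⊆ A := Finset.mem_powerset.1 (Finset.mem_filter.1 ht).1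
  exact mul_nonneg (Finset.prod_nonneg fun i hi => (h i (ht hi)).1)
    (Finset.prod_nonneg fun i hi => sub_nonneg.2 (h i (Finset.mem_sdiff.1 hi).1).2)

/-- Replacing a device by one with a larger success probability does not decrease `S`. -/
theorem S_insert_le_S_insert (μ : ℕ → ℝ) {A : Finset ℕ} (h : ∀ i ∈ A, 0 ≤ μ i ∧ μ i ≤ 1)
    {a b : ℕ} (ha : a ∉ A) (hb : b ∉ A) (hab : μ a ≤ μ b) (Y : ℕ) :
    S μ (insert a A) Y ≤ S μ (insert b A) Y := by
  rw [S_insert μ ha, S_insert μ hb]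
  have := S_antitone μ h (Nat.sub_le Y 1)
  gcongr

theorem S_le_S_Icc (n : ℕ) (μ : ℕ → ℝ)
    (hbound : ∀ i, 1 ≤ i → i ≤ n → 0 ≤ μ i ∧ μ i ≤ 1)
    (hmono : ∀ i j, 1 ≤ i → i ≤ j → j ≤ n → μ j ≤ μ i) (Y ng : ℕ) (hngn : ng ≤ n)
    (A : Finset ℕ) (hA : A ⊆ Finset.Icc 1 n) (hcard : A.card = ng) :
    S μ A Y ≤ S μ (Finset.Icc 1 ng) Y := by
  induction hk : (A \ Finset.Icc 1 ng).card using Nat.strong_induction_on generalizing A with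
  | _ k ih =>
  have hc : A.card = (Finset.Icc 1 ng).card := by simp [hcard]
  by_cases hsub : A ⊆ Finset.Icc 1 ng
  · rw [Finset.eq_of_subset_of_card_le hsub hc.ge]
  have hsub' : ¬ Finset.Icc 1 ng ⊆ A := fun h =>
    hsub (Finset.eq_of_subset_of_card_le h hc.le).ge
  obtain ⟨a, haA, haI⟩ := Finset.not_subset.1 hsub
  obtain ⟨b, hbI, hbA⟩ := Finset.not_subset.1 hsub'
  have ha := Finset.mem_Icc.1 (hA haA)
  have hb := Finset.mem_Icc.1 hbI
  have hlt : ng < a := by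
    by_contra! hle
    exact haI (Finset.mem_Icc.2 ⟨ha.1, hle⟩)
  have hbe : b ∉ A.erase a := fun h => hbA (Finset.mem_of_mem_erase h)
  have hstep : S μ A Y ≤ S μ (insert b (A.erase a)) Y := by
    conv_lhs => rw [← Finset.insert_erase haA]
    refine S_insert_le_S_insert μ (fun i hi => ?_) (Finset.notMem_erase a A) hbe
      (hmono b a hb.1 (by lia) ha.2) Y
    have hi := Finset.mem_Icc.1 (hA (Finset.mem_of_mem_erase hi))
    exact hbound i hi.1 hi.2
  refine hstep.trans (ih _ ?_ _ ?_ ?_ rfl)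
  · rw [← hk, Finset.insert_sdiff_of_mem _ hbI, Finset.erase_sdiff_comm]
    exact Finset.card_erase_lt_of_mem (Finset.mem_sdiff.2 ⟨haA, haI⟩)
  · exact Finset.insert_subset (Finset.mem_Icc.2 ⟨hb.1, hb.2.trans hngn⟩)
      ((Finset.erase_subset a A).trans hA)
  · rw [Finset.card_insert_of_notMem hbe, Finset.card_erase_add_one haA, hcard]

theorem stmt_4 (n : ℕ) (μ : ℕ → ℝ)
    (hbound : ∀ i, 1 ≤ i → i ≤ n → 0 ≤ μ i ∧ μ i ≤ 1)
    (hmono : ∀ i j, 1 ≤ i → i ≤ j → j ≤ n → μ j ≤ μ i)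
    (Y : ℕ) (η : ℝ) (hη : 0 ≤ η) (ng : ℕ) (hng1 : 1 ≤ ng) (hngn : ng ≤ n) :
    ∀ A ⊆ Finset.Icc 1 n, A.card = ng →
      u μ Y η A ≤ u μ Y η (Finset.Icc 1 ng) := by
  intro A hA hcard
  have h := S_le_S_Icc n μ hbound hmono Y ng hngn A hA hcard
  simpa [u, hcard] using h
end

section
/- (Lipschitz bound on the success probability in the device probabilities.) Let A ⊆ ℕ be a nonempty finite set, let Y ∈ ℕ with 1 ≤ Y ≤ |A|, and let μ₁, μ₂ : ℕ → ℝ take values in [0,1] on A. Then |S(μ₁, A, Y) − S(μ₂, A, Y)| ≤ |A| · C(|A| − 1, Y − 1) · max_{ν ∈ A} |μ₁(ν) − μ₂(ν)|, where C(n, k) denotes the binomial coefficient. -/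
theorem S_zero (μ : ℕ → ℝ) (A : Finset ℕ) : S μ A 0 = 1 := by
  have h := Finset.prod_add μ (fun ν => 1 - μ ν) A
  simp only [add_sub_cancel, Finset.prod_const_one] at h
  simp [S, ← h]

theorem S_insert_succ (μ : ℕ → ℝ) {A : Finset ℕ} {a : ℕ} (ha : a ∉ A) (Y : ℕ) :
    S μ (insert a A) (Y + 1) = μ a * S μ A Y + (1 - μ a) * S μ A (Y + 1) := by
  simp only [S, Finset.sum_filter]
  rw [Finset.sum_powerset_insert ha, Finset.mul_sum, Finset.mul_sum, add_comm]
  congr 1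
  · refine Finset.sum_congr rfl fun t ht => ?_
    have hat : a ∉ t := fun h => ha (Finset.mem_powerset.1 ht h)
    rw [Finset.card_insert_of_notMem hat, Finset.prod_insert hat, Finset.insert_sdiff_insert,
      Finset.sdiff_insert_of_notMem ha]
    simp only [add_le_add_iff_right, mul_ite, mul_zero, mul_assoc]
  · refine Finset.sum_congr rfl fun t ht => ?_
    have hat : a ∉ t := fun h => ha (Finset.mem_powerset.1 ht h)
    rw [Finset.insert_sdiff_of_notMem _ hat,
      Finset.prod_insert fun h => ha (Finset.mem_sdiff.1 h).1]
    simp only [mul_ite, mul_zero, mul_left_comm]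

section Bounds

variable {μ : ℕ → ℝ} {A : Finset ℕ}

theorem S_summand_nonneg (hμ : ∀ ν ∈ A, 0 ≤ μ ν ∧ μ ν ≤ 1) {t : Finset ℕ} (ht : t ⊆ A) :
    0 ≤ (∏ ν ∈ t, μ ν) * ∏ ν ∈ A \ t, (1 - μ ν) :=
  mul_nonneg (Finset.prod_nonneg fun ν hν => (hμ ν (ht hν)).1)
    (Finset.prod_nonneg fun ν hν => sub_nonneg.2 (hμ ν (Finset.mem_sdiff.1 hν).1).2)

theorem S_nonneg (hμ : ∀ ν ∈ A, 0 ≤ μ ν ∧ μ ν ≤ 1) (Y : ℕ) : 0 ≤ S μ A Y :=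
  Finset.sum_nonneg fun _ ht =>
    S_summand_nonneg hμ (Finset.mem_powerset.1 (Finset.mem_filter.1 ht).1)

theorem S_antitone_s9 (hμ : ∀ ν ∈ A, 0 ≤ μ ν ∧ μ ν ≤ 1) : Antitone (S μ A) := fun _ _ hYZ =>
  Finset.sum_le_sum_of_subset_of_nonneg
    (Finset.monotone_filter_right _ fun _ _ h => hYZ.trans h) fun _ ht _ =>
      S_summand_nonneg hμ (Finset.mem_powerset.1 (Finset.mem_filter.1 ht).1)

theorem S_le_one (hμ : ∀ ν ∈ A, 0 ≤ μ ν ∧ μ ν ≤ 1) (Y : ℕ) : S μ A Y ≤ 1 :=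
  (S_antitone_s9 hμ Y.zero_le).trans_eq (S_zero μ A)

end Bounds

theorem abs_S_sub_S_le_sum (μ₁ μ₂ : ℕ → ℝ) (A : Finset ℕ) (Y : ℕ)
    (h₁ : ∀ ν ∈ A, 0 ≤ μ₁ ν ∧ μ₁ ν ≤ 1) (h₂ : ∀ ν ∈ A, 0 ≤ μ₂ ν ∧ μ₂ ν ≤ 1) :
    |S μ₁ A Y - S μ₂ A Y| ≤ ∑ ν ∈ A, |μ₁ ν - μ₂ ν| := by
  induction A using Finset.induction_on generalizing Y with
  | empty => simp [S, Finset.sum_filter]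
  | insert a A ha ih =>
    cases Y with
    | zero =>
      rw [S_zero, S_zero, sub_self, abs_zero]
      exact Finset.sum_nonneg fun _ _ => abs_nonneg _
    | succ Y =>
      obtain ⟨ha₀, ha₁⟩ := h₁ a (Finset.mem_insert_self a A)
      replace h₁ := fun ν hν => h₁ ν (Finset.mem_insert_of_mem hν)
      replace h₂ := fun ν hν => h₂ ν (Finset.mem_insert_of_mem hν)
      have hd : |S μ₂ A Y - S μ₂ A (Y + 1)| ≤ 1 := by
        rw [abs_of_nonneg (sub_nonneg.2 (S_antitone_s9 h₂ Y.le_succ))]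
        linarith [S_le_one h₂ Y, S_nonneg h₂ (Y + 1)]
      rw [S_insert_succ _ ha, S_insert_succ _ ha, Finset.sum_insert ha]
      set M := ∑ ν ∈ A, |μ₁ ν - μ₂ ν|
      calc
        _ = |(μ₁ a - μ₂ a) * (S μ₂ A Y - S μ₂ A (Y + 1)) + μ₁ a * (S μ₁ A Y - S μ₂ A Y) +
              (1 - μ₁ a) * (S μ₁ A (Y + 1) - S μ₂ A (Y + 1))| := by congr 1; ring
        _ ≤ |μ₁ a - μ₂ a| * |S μ₂ A Y - S μ₂ A (Y + 1)| + μ₁ a * |S μ₁ A Y - S μ₂ A Y| +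
              (1 - μ₁ a) * |S μ₁ A (Y + 1) - S μ₂ A (Y + 1)| := by
          refine (abs_add_three _ _ _).trans_eq ?_
          rw [abs_mul, abs_mul, abs_mul, abs_of_nonneg ha₀, abs_of_nonneg (sub_nonneg.2 ha₁)]
        _ ≤ |μ₁ a - μ₂ a| * 1 + μ₁ a * M + (1 - μ₁ a) * M := by
          have := sub_nonneg.2 ha₁
          gcongr
          · exact ih Y h₁ h₂
          · exact ih (Y + 1) h₁ h₂
        _ = |μ₁ a - μ₂ a| + M := by ring

theorem stmt_9 (A : Finset ℕ) (hA : A.Nonempty) (Y : ℕ) (hY1 : 1 ≤ Y) (hY2 : Y ≤ A.card)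
    (μ₁ μ₂ : ℕ → ℝ)
    (hb1 : ∀ ν ∈ A, 0 ≤ μ₁ ν ∧ μ₁ ν ≤ 1)
    (hb2 : ∀ ν ∈ A, 0 ≤ μ₂ ν ∧ μ₂ ν ≤ 1) :
    |S μ₁ A Y - S μ₂ A Y|
      ≤ (A.card : ℝ) * (Nat.choose (A.card - 1) (Y - 1) : ℝ) *
          A.sup' hA (fun ν => |μ₁ ν - μ₂ ν|) := by
  have hM : 0 ≤ A.sup' hA (fun ν => |μ₁ ν - μ₂ ν|) := by
    obtain ⟨a, ha⟩ := hA
    exact (abs_nonneg _).trans (Finset.le_sup' (fun ν => |μ₁ ν - μ₂ ν|) ha)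
  have hC : (1 : ℝ) ≤ Nat.choose (A.card - 1) (Y - 1) :=
    mod_cast Nat.choose_pos (Nat.sub_le_sub_right hY2 1)
  calc
    _ ≤ ∑ ν ∈ A, |μ₁ ν - μ₂ ν| := abs_S_sub_S_le_sum μ₁ μ₂ A Y hb1 hb2
    _ ≤ A.card * A.sup' hA (fun ν => |μ₁ ν - μ₂ ν|) := by
      rw [← nsmul_eq_mul]
      exact Finset.sum_le_card_nsmul _ _ _ fun ν hν =>
        Finset.le_sup' (fun ν => |μ₁ ν - μ₂ ν|) hν
    _ ≤ _ := by
      gcongr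
      exact le_mul_of_one_le_right (Nat.cast_nonneg _) hC
end
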